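/- arXiv:2310.12629 — 5 statements merged into one kernel-verified Lean document; each statement's English description precedes it below -/
import Mathlib

section
/- Let n ≥ 1, let x ∈ ℝ^n have x_i > 0 for all i, let M := max_{i∈[n]} (1/x_i), L := {ℓ ∈ ℝ^n : 0 ≤ ℓ_i ≤ M for all i, ℓ·x = 1}, and Δ(ℓ) := Σ_{i=1}^n ℓ_i x_i ln(n ℓ_i x_i) (with 0·ln 0 = 0). Let ε > 0, η ≥ 2 ln(n)/ε, and α ≥ 1. Let C ⊆ ℝ^n be finite and nonempty, let λ be a probability distribution on C and set v := Σ_{c∈C} λ_c c. Suppose there exist k ≥ 1, vectors ℓ_1, …, ℓ_k ∈ L and c_1, …, c_k ∈ C such that c_j·ℓ_j ≤ α for every j ∈ [k], and such that sup_{ℓ∈L} ( ℓ·v − (1/η)Δ(ℓ) ) − max_{j∈[k]} c_j·ℓ_j ≤ ε/2. Then for every ℓ ∈ L, v·ℓ ≤ (α + ε)·(x·ℓ) = α + ε. -/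
open Finset

/-- The relative entropy of a point of the simplex to the uniform distribution is nonnegative. -/
theorem sum_mul_log_card_mul_nonneg {n : ℕ} (hn : 1 ≤ n) {t : Fin n → ℝ}
    (h0 : ∀ i, 0 ≤ t i) (h1 : ∑ i, t i = 1) :
    0 ≤ ∑ i, t i * Real.log ((n : ℝ) * t i) := by
  have hn' : (0 : ℝ) < n := by exact_mod_cast hn
  calc (0 : ℝ) = ∑ i, (t i - 1 / (n : ℝ)) := by
        rw [Finset.sum_sub_distrib, h1]
        simp [hn'.ne']
    _ ≤ _ := by
        refine Finset.sum_le_sum fun i _ => ?_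
        rcases (h0 i).eq_or_lt with h | h
        · simp [← h]
        · have hlog := Real.one_sub_inv_le_log_of_pos (mul_pos hn' h)
          calc t i - 1 / (n : ℝ) = t i * (1 - ((n : ℝ) * t i)⁻¹) := by field_simp
            _ ≤ _ := mul_le_mul_of_nonneg_left hlog h.le

/-- The relative entropy of a point of the simplex to the uniform distribution is at most
`log n`. -/
theorem sum_mul_log_card_mul_le_log {n : ℕ} (hn : 1 ≤ n) {t : Fin n → ℝ}
    (h0 : ∀ i, 0 ≤ t i) (h1 : ∑ i, t i = 1) :
    ∑ i, t i * Real.log ((n : ℝ) * t i) ≤ Real.log n := by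
  have hn' : (0 : ℝ) < n := by exact_mod_cast hn
  calc _ ≤ ∑ i, t i * Real.log n := by
        refine Finset.sum_le_sum fun i _ => ?_
        rcases (h0 i).eq_or_lt with h | h
        · simp [← h]
        · have hle : t i ≤ 1 := h1 ▸ Finset.single_le_sum (fun j _ => h0 j) (Finset.mem_univ i)
          exact mul_le_mul_of_nonneg_left
            (Real.log_le_log (mul_pos hn' h) (mul_le_of_le_one_right hn'.le hle)) h.le
    _ = Real.log n := by rw [← Finset.sum_mul, h1, one_mul]

/-- Lemma 1: correctness of the stopping criterion of metarounding-by-ERLPBoost.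
If the optimality gap is at most `ε/2` and every oracle value `c_j ⬝ ℓ_j` is at most `α`,
then the mean `v` of the distribution `λ` satisfies `v ⬝ ℓ ≤ (α + ε) (x ⬝ ℓ)` on `L`. -/
theorem stmt_1 (n : ℕ) (hn : 1 ≤ n) (x : Fin n → ℝ) (hx : ∀ i, 0 < x i)
    (M : ℝ)
    (hM : M = Finset.univ.sup' (⟨⟨0, hn⟩, Finset.mem_univ _⟩ : (Finset.univ : Finset (Fin n)).Nonempty)
      (fun i => 1 / x i))
    (L : Set (Fin n → ℝ))
    (hL : L = {ℓ : Fin n → ℝ | (∀ i, 0 ≤ ℓ i ∧ ℓ i ≤ M) ∧ (∑ i, ℓ i * x i) = 1})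
    (Δ : (Fin n → ℝ) → ℝ)
    (hΔ : ∀ ℓ : Fin n → ℝ, Δ ℓ = ∑ i, ℓ i * x i * Real.log ((n : ℝ) * (ℓ i * x i)))
    (ε η α : ℝ) (hε : 0 < ε) (hη : 2 * Real.log n / ε ≤ η) (hα : 1 ≤ α)
    (C : Finset (Fin n → ℝ)) (hC : C.Nonempty)
    (lam : (Fin n → ℝ) → ℝ) (hlam0 : ∀ c ∈ C, 0 ≤ lam c) (hlam1 : ∑ c ∈ C, lam c = 1)
    (v : Fin n → ℝ) (hv : ∀ i, v i = ∑ c ∈ C, lam c * c i)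
    (k : ℕ) (hk : 1 ≤ k)
    (ℓvec cvec : Fin k → (Fin n → ℝ))
    (hℓvec : ∀ j, ℓvec j ∈ L) (hcvec : ∀ j, cvec j ∈ C)
    (horacle : ∀ j, (∑ i, cvec j i * ℓvec j i) ≤ α)
    (hgap :
      sSup {r : ℝ | ∃ ℓ ∈ L, r = (∑ i, ℓ i * v i) - (1 / η) * Δ ℓ}
        - Finset.univ.sup' (⟨⟨0, hk⟩, Finset.mem_univ _⟩ : (Finset.univ : Finset (Fin k)).Nonempty)
            (fun j => ∑ i, cvec j i * ℓvec j i)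
        ≤ ε / 2) :
    ∀ ℓ ∈ L, (∑ i, v i * ℓ i) ≤ (α + ε) * (∑ i, x i * ℓ i) := by
  subst hL
  have hlog : 0 ≤ Real.log n := Real.log_natCast_nonneg n
  have hη0 : 0 ≤ η := le_trans (by positivity) hη
  have hΔ0 : ∀ ℓ : Fin n → ℝ, (∀ i, 0 ≤ ℓ i ∧ ℓ i ≤ M) → ∑ i, ℓ i * x i = 1 → 0 ≤ Δ ℓ :=
    fun ℓ h h1 => hΔ ℓ ▸
      sum_mul_log_card_mul_nonneg hn (fun i => mul_nonneg (h i).1 (hx i).le) h1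
  have hbdd : BddAbove {r : ℝ | ∃ ℓ ∈ {ℓ : Fin n → ℝ | (∀ i, 0 ≤ ℓ i ∧ ℓ i ≤ M) ∧
      (∑ i, ℓ i * x i) = 1}, r = (∑ i, ℓ i * v i) - (1 / η) * Δ ℓ} := by
    refine ⟨∑ i, M * |v i|, ?_⟩
    rintro r ⟨ℓ, ⟨hb, h1⟩, rfl⟩
    have hsum : ∑ i, ℓ i * v i ≤ ∑ i, M * |v i| := Finset.sum_le_sum fun i _ =>
      (mul_le_mul_of_nonneg_left (le_abs_self _) (hb i).1).trans
        (mul_le_mul_of_nonneg_right (hb i).2 (abs_nonneg _))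
    have hpos : 0 ≤ 1 / η * Δ ℓ := mul_nonneg (by positivity) (hΔ0 ℓ hb h1)
    linarith
  rintro ℓ ⟨hb, h1⟩
  have hle := le_csSup hbdd ⟨ℓ, ⟨hb, h1⟩, rfl⟩
  have hmax := Finset.sup'_le (⟨⟨0, hk⟩, Finset.mem_univ _⟩ : (Finset.univ : Finset (Fin k)).Nonempty)
    (fun j => ∑ i, cvec j i * ℓvec j i) (fun j _ => horacle j)
  have hΔle : Δ ℓ ≤ Real.log n := hΔ ℓ ▸
    sum_mul_log_card_mul_le_log hn (fun i => mul_nonneg (hb i).1 (hx i).le) h1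
  have hreg : 1 / η * Δ ℓ ≤ ε / 2 := by
    rcases hη0.eq_or_lt with h | h
    · rw [← h]
      simpa using (half_pos hε).le
    · rw [div_le_iff₀ hε] at hη
      rw [one_div_mul_eq_div, div_le_iff₀ h]
      linarith
  simp only [mul_comm (x _), mul_comm (v _), h1]
  linarith
end

section
/- Let n ≥ 1, η > 0, D > 0, and let F : ℝ^n → ℝ be convex, differentiable, and η-smooth with respect to ‖·‖∞ (i.e., F(z') ≤ F(z) + ∇F(z)·(z'−z) + (η/2)‖z'−z‖∞² for all z, z'). Let c_1, …, c_{k+1} ∈ ℝ^n with ‖c_j‖∞ ≤ D for every j. Let v ∈ conv{c_1, …, c_k} satisfy ∇F(v)·v ≥ F(v), let v' minimize F over conv{c_1, …, c_{k+1}}, and let γ, γ' ∈ ℝ satisfy γ' ≥ γ and γ ≥ ∇F(v)·c_{k+1}. Define ε_k := F(v) − γ and ε_{k+1} := F(v') − γ'. Then for every μ ∈ [0,1], ε_{k+1} ≤ (1 − μ) ε_k + 2 η μ² D². -/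
open Finset

/-- Lemma 2 (per-iteration Frank–Wolfe recurrence): for a convex, differentiable,
`η`-smooth (w.r.t. `‖·‖∞`, the norm on `Fin n → ℝ`) function `F`, the optimality
gaps satisfy `ε_{k+1} ≤ (1 - μ) ε_k + 2 η μ² D²` for every `μ ∈ [0, 1]`. -/
theorem stmt_3 (n : ℕ) (hn : 1 ≤ n) (η D : ℝ) (hη : 0 < η) (hD : 0 < D)
    (F : (Fin n → ℝ) → ℝ)
    (hconv : ConvexOn ℝ Set.univ F)
    (hdiff : Differentiable ℝ F)
    (hsmooth : ∀ z z' : Fin n → ℝ,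
      F z' ≤ F z + fderiv ℝ F z (z' - z) + η / 2 * ‖z' - z‖ ^ 2)
    (k : ℕ) (hk : 1 ≤ k)
    (c : Fin (k + 1) → (Fin n → ℝ))
    (hc : ∀ j, ‖c j‖ ≤ D)
    (v : Fin n → ℝ)
    (hv : v ∈ convexHull ℝ (Set.range fun j : Fin k => c j.castSucc))
    (hvF : F v ≤ fderiv ℝ F v v)
    (v' : Fin n → ℝ)
    (hv' : v' ∈ convexHull ℝ (Set.range c))
    (hv'min : ∀ w ∈ convexHull ℝ (Set.range c), F v' ≤ F w)
    (γ γ' : ℝ) (hγγ' : γ ≤ γ') (hγ : fderiv ℝ F v (c (Fin.last k)) ≤ γ) :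
    ∀ μ ∈ Set.Icc (0 : ℝ) 1,
      F v' - γ' ≤ (1 - μ) * (F v - γ) + 2 * η * μ ^ 2 * D ^ 2 := by
  rintro μ ⟨hμ0, hμ1⟩
  have hvD : ‖v‖ ≤ D := by
    have hsub : convexHull ℝ (Set.range fun j : Fin k => c j.castSucc) ⊆
        Metric.closedBall 0 D :=
      convexHull_min (Set.range_subset_iff.2 fun j => by simpa using hc j.castSucc)
        (convex_closedBall 0 D)
    simpa using hsub hv
  have hv_mem : v ∈ convexHull ℝ (Set.range c) :=
    convexHull_mono (Set.range_subset_iff.2 fun j => Set.mem_range_self (Fin.castSucc j)) hv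
  have hc_mem : c (Fin.last k) ∈ convexHull ℝ (Set.range c) :=
    subset_convexHull ℝ _ (Set.mem_range_self _)
  have hmin := hv'min _ ((convex_convexHull ℝ (Set.range c)).add_smul_sub_mem hv_mem hc_mem
    ⟨hμ0, hμ1⟩)
  have hstep := hsmooth v (v + μ • (c (Fin.last k) - v))
  rw [add_sub_cancel_left, map_smul, map_sub, smul_eq_mul, norm_smul, Real.norm_eq_abs,
    mul_pow, sq_abs] at hstep
  have hnorm : ‖c (Fin.last k) - v‖ ≤ 2 * D := by
    linarith [norm_sub_le (c (Fin.last k)) v, hc (Fin.last k)]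
  have hquad : η / 2 * (μ ^ 2 * ‖c (Fin.last k) - v‖ ^ 2) ≤ η / 2 * (μ ^ 2 * (2 * D) ^ 2) := by
    gcongr
  have hlin : μ * (fderiv ℝ F v (c (Fin.last k)) - fderiv ℝ F v v) ≤ μ * (γ - F v) := by
    gcongr
  linarith
end

section
/- Let η > 0, D > 0, and let (ε_k)_{k≥0} be a sequence of real numbers such that for every k ≥ 0 and every μ ∈ [0,1], ε_{k+1} ≤ (1 − μ) ε_k + 2 η μ² D². Then for every k ≥ 1, ε_k ≤ 8 η D² / (k + 2). -/
/-- The inductive convergence bound in the proof of Theorem 2: a real sequence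
satisfying the Frank–Wolfe recurrence for all step sizes `μ ∈ [0, 1]` decays at
rate `O(η D² / k)`. -/
theorem stmt_4 (η D : ℝ) (hη : 0 < η) (hD : 0 < D) (e : ℕ → ℝ)
    (hrec : ∀ k : ℕ, ∀ μ ∈ Set.Icc (0 : ℝ) 1,
      e (k + 1) ≤ (1 - μ) * e k + 2 * η * μ ^ 2 * D ^ 2) :
    ∀ k : ℕ, 1 ≤ k → e k ≤ 8 * η * D ^ 2 / (k + 2) := by
  intro k hk
  have hC : 0 < η * D ^ 2 := by positivity
  induction k, hk using Nat.le_induction with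
  | base =>
    have h := hrec 0 1 (by simp)
    norm_num at h ⊢
    linarith
  | succ k _ ih =>
    have hk2 : (0 : ℝ) < k + 2 := by positivity
    have hμ : 2 / ((k : ℝ) + 2) ≤ 1 := by
      rw [div_le_one hk2]
      linarith [k.cast_nonneg (α := ℝ)]
    calc e (k + 1)
        ≤ (1 - 2 / ((k : ℝ) + 2)) * e k + 2 * η * (2 / ((k : ℝ) + 2)) ^ 2 * D ^ 2 :=
          hrec k _ ⟨by positivity, hμ⟩
      _ ≤ (1 - 2 / ((k : ℝ) + 2)) * (8 * η * D ^ 2 / (k + 2))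
            + 2 * η * (2 / ((k : ℝ) + 2)) ^ 2 * D ^ 2 := by
          have := mul_le_mul_of_nonneg_left ih (sub_nonneg.2 hμ)
          linarith
      _ = 8 * (η * D ^ 2) * (k + 1) / (k + 2) ^ 2 := by
          field_simp
          ring
      _ ≤ 8 * η * D ^ 2 / ((k + 1 : ℕ) + 2) := by
          push_cast
          rw [div_le_div_iff₀ (by positivity) (by positivity)]
          nlinarith
end

section
/- Let n ≥ 2, ε > 0, D > 0, set η := 2 ln(n)/ε, and let (ε_k)_{k≥0} be a sequence of real numbers such that for every k ≥ 0 and every μ ∈ [0,1], ε_{k+1} ≤ (1 − μ) ε_k + 2 η μ² D². Then for every integer K ≥ 32 D² ln(n) / ε², ε_K ≤ ε/2. -/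
/-- The `O(1/k)` rate of a sequence satisfying the Frank–Wolfe recurrence with curvature
constant `C`, obtained from the step sizes `μ = 2 / (k + 2)`. -/
theorem le_four_mul_div_of_frankWolfe_rec {C : ℝ} (hC : 0 ≤ C) {e : ℕ → ℝ}
    (hrec : ∀ k : ℕ, ∀ μ ∈ Set.Icc (0 : ℝ) 1, e (k + 1) ≤ (1 - μ) * e k + C * μ ^ 2) (k : ℕ) :
    e (k + 1) ≤ 4 * C / (k + 3) := by
  induction k with
  | zero =>
    have h := hrec 0 1 (by norm_num)
    norm_num at h ⊢
    linarith
  | succ k ih =>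
    have hk : (0 : ℝ) ≤ k := k.cast_nonneg
    have hμ : 2 / ((k : ℝ) + 3) ≤ 1 := by
      rw [div_le_one (by positivity)]
      linarith
    calc e (k + 1 + 1)
        ≤ (1 - 2 / ((k : ℝ) + 3)) * e (k + 1) + C * (2 / ((k : ℝ) + 3)) ^ 2 :=
          hrec (k + 1) _ ⟨by positivity, hμ⟩
      _ ≤ (1 - 2 / ((k : ℝ) + 3)) * (4 * C / (k + 3)) + C * (2 / ((k : ℝ) + 3)) ^ 2 := by
          gcongr
      _ = 4 * C * (k + 2) / (k + 3) ^ 2 := by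
          field_simp
          ring
      _ ≤ 4 * C / ((k + 1 : ℕ) + 3) := by
          rw [div_le_div_iff₀ (by positivity) (by positivity)]
          push_cast
          nlinarith

/-- Theorem 2 in sequence form: with `η = 2 ln(n)/ε`, a sequence satisfying the
Frank–Wolfe recurrence reaches gap at most `ε/2` within `K = 32 D² ln(n)/ε²`
iterations. -/
theorem stmt_5 (n : ℕ) (hn : 2 ≤ n) (ε D η : ℝ) (hε : 0 < ε) (hD : 0 < D)
    (hη : η = 2 * Real.log n / ε) (e : ℕ → ℝ)
    (hrec : ∀ k : ℕ, ∀ μ ∈ Set.Icc (0 : ℝ) 1,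
      e (k + 1) ≤ (1 - μ) * e k + 2 * η * μ ^ 2 * D ^ 2) :
    ∀ K : ℕ, 32 * D ^ 2 * Real.log n / ε ^ 2 ≤ K → e K ≤ ε / 2 := by
  intro K hK
  have hlog : 0 < Real.log n := Real.log_pos (by exact_mod_cast hn)
  cases K with
  | zero =>
    have : 0 < 32 * D ^ 2 * Real.log n / ε ^ 2 := by positivity
    rw [Nat.cast_zero] at hK
    linarith
  | succ k =>
    have hη0 : 0 ≤ η := by rw [hη]; positivity
    have hrate := le_four_mul_div_of_frankWolfe_rec (C := 2 * η * D ^ 2) (by positivity)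
      (fun k μ hμ => (hrec k μ hμ).trans_eq (by ring)) k
    refine hrate.trans ?_
    rw [div_le_iff₀ (by positivity)] at hK
    rw [div_le_iff₀ (by positivity), hη]
    push_cast at hK
    field_simp
    nlinarith [sq_nonneg ε]
end

section
/- Let n ≥ 1, let C ⊆ ℝ^n be a finite nonempty set of vectors with nonnegative entries, let x ∈ ℝ^n have nonnegative entries, and let α ≥ 1. Suppose that for every ℓ ∈ ℝ^n with nonnegative entries there exists c ∈ C with c·ℓ ≤ α (x·ℓ). Then there exists a probability distribution λ on C such that Σ_{c∈C} λ_c c_i ≤ α x_i for every i ∈ [n]. -/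
open Finset

/-- A linear functional that is bounded above on the lower orthant `Set.Iic y`
is nonnegative on nonnegative vectors. -/
theorem nonneg_of_forall_mem_Iic_lt {E : Type*} [AddCommGroup E] [PartialOrder E]
    [IsOrderedAddMonoid E] [Module ℝ E] [PosSMulMono ℝ E] {f : E →ₗ[ℝ] ℝ} {y : E} {u : ℝ}
    (hf : ∀ a ∈ Set.Iic y, f a < u) {z : E} (hz : 0 ≤ z) : 0 ≤ f z := by
  by_contra! hneg
  have hy : f y < u := hf y Set.self_mem_Iic
  have ht : 0 ≤ (u - f y) / -f z := div_nonneg (by linarith) (by linarith)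
  have h := hf (y - ((u - f y) / -f z) • z) (sub_le_self y (smul_nonneg ht hz))
  have hcancel : (u - f y) / -f z * f z = -(u - f y) := by
    have := hneg.ne
    field_simp
  rw [map_sub, map_smul, smul_eq_mul, hcancel] at h
  linarith

/-- A finite set of vectors has a convex combination below `y` as soon as every nonnegative
loss vector admits an element of the set whose loss is at most that of `y`. -/
theorem exists_mem_convexHull_le {ι : Type*} [Fintype ι] {C : Finset (ι → ℝ)} {y : ι → ℝ}
    (h : ∀ l : ι → ℝ, 0 ≤ l → ∃ c ∈ C, ∑ i, c i * l i ≤ ∑ i, y i * l i) :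
    ∃ z ∈ convexHull ℝ (C : Set (ι → ℝ)), z ≤ y := by
  classical
  by_contra! hlt
  have hdisj : Disjoint (Set.Iic y) (convexHull ℝ (C : Set (ι → ℝ))) :=
    Set.disjoint_left.2 fun z hzy hz => hlt z hz hzy
  obtain ⟨f, u, v, hu, huv, hv⟩ := geometric_hahn_banach_closed_compact (convex_Iic y)
    isClosed_Iic (convex_convexHull ℝ _) (C.finite_toSet.isCompact_convexHull ℝ) hdisj
  have hsum (a : ι → ℝ) : f a = ∑ i, a i * f (Pi.single i 1) := by
    conv_lhs => rw [pi_eq_sum_univ' a, map_sum]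
    simp
  obtain ⟨c, hc, hle⟩ := h (fun i => f (Pi.single i 1)) fun i =>
    nonneg_of_forall_mem_Iic_lt (f := f.toLinearMap) hu (Pi.single_nonneg.2 zero_le_one)
  rw [← hsum, ← hsum] at hle
  have hyu := hu y Set.self_mem_Iic
  have hvc := hv c (subset_convexHull ℝ _ hc)
  linarith

/-- Carr–Vempala existence statement underlying metarounding: if for every
nonnegative loss vector `ℓ` some `c ∈ C` satisfies `c·ℓ ≤ α (x·ℓ)`, then there is
a distribution `λ` over `C` whose mean is dominated coordinatewise by `α x`. -/
theorem stmt_10 (n : ℕ) (hn : 1 ≤ n) (C : Finset (Fin n → ℝ)) (hC : C.Nonempty)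
    (hCpos : ∀ c ∈ C, ∀ i, 0 ≤ c i)
    (x : Fin n → ℝ) (hx : ∀ i, 0 ≤ x i) (α : ℝ) (hα : 1 ≤ α)
    (horacle : ∀ ℓ : Fin n → ℝ, (∀ i, 0 ≤ ℓ i) →
      ∃ c ∈ C, (∑ i, c i * ℓ i) ≤ α * ∑ i, x i * ℓ i) :
    ∃ lam : (Fin n → ℝ) → ℝ,
      (∀ c ∈ C, 0 ≤ lam c) ∧ (∑ c ∈ C, lam c) = 1 ∧
      ∀ i, (∑ c ∈ C, lam c * c i) ≤ α * x i := by
  obtain ⟨z, hz, hzy⟩ := exists_mem_convexHull_le (C := C) (y := α • x) fun l hl => by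
    simpa [mul_assoc, Finset.mul_sum] using horacle l hl
  obtain ⟨w, hw, hw1, rfl⟩ := Finset.mem_convexHull'.1 hz
  exact ⟨w, hw, hw1, fun i => by simpa using hzy i⟩
end
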